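/- Let p be a prime and set n = p−1. Then every pair (i,j) of nonnegative integers with i+j ≤ p−4 is Fermat-admissible for n and p; consequently the number of Fermat-admissible pairs equals (p−2)(p−3)/2, the full genus of F_{p−1}. (Equivalently, the rank of the Cartier operator on the Fermat curve F_{p−1} equals its genus (p−2)(p−3)/2, so F_{p−1} is ordinary.) -/

import Mathlib

/-- A pair `(i, j)` is *Fermat-admissible* for `n` and `p` if there exist integers
`h, k` with `0 ≤ h ≤ p - 1` and `0 ≤ k ≤ h` such that `n*(p-1-h) + i ≡ p-1 (mod p)`
and `n*k + j ≡ p-1 (mod p)`. -/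
def FermatAdmissible (n p i j : ℕ) : Prop :=
  ∃ h k : ℕ, h ≤ p - 1 ∧ k ≤ h ∧
    n * (p - 1 - h) + i ≡ p - 1 [MOD p] ∧ n * k + j ≡ p - 1 [MOD p]

/-- There are `N * (N + 1) / 2` pairs of natural numbers with sum less than `N`. -/
theorem two_mul_ncard_add_lt (N : ℕ) :
    2 * {ij : ℕ × ℕ | ij.1 + ij.2 < N}.ncard = (N + 1) * N := by
  have h : {ij : ℕ × ℕ | ij.1 + ij.2 < N} =
      ((Finset.range N).biUnion Finset.HasAntidiagonal.antidiagonal : Finset (ℕ × ℕ)) := by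
    ext ij
    simp
  rw [h, Set.ncard_coe_finset, Finset.card_biUnion
    fun _ _ _ _ hne => Finset.disjoint_left.2 fun x hx hy =>
      hne ((Finset.HasAntidiagonal.mem_antidiagonal.1 hx).symm.trans (Finset.HasAntidiagonal.mem_antidiagonal.1 hy))]
  simp only [Finset.Nat.card_antidiagonal]
  clear h
  induction N with
  | zero => rfl
  | succ N ih => rw [Finset.sum_range_succ, mul_add, ih]; ring

/-- Modulo `m + 1`, multiplication by `m` is negation. -/
theorem mul_succ_add_modEq (m j : ℕ) : m * (j + 1) + j ≡ m [MOD m + 1] := by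
  rw [show m * (j + 1) + j = m + (m + 1) * j by ring]
  simp [Nat.ModEq]

theorem fermatAdmissible_of_add_le {p i j : ℕ} (h : i + j + 3 ≤ p) :
    FermatAdmissible (p - 1) p i j := by
  obtain ⟨m, rfl⟩ : ∃ m, p = m + 1 := ⟨p - 1, by omega⟩
  refine ⟨m - 1 - i, j + 1, by omega, by omega, ?_, ?_⟩
  · rw [show m + 1 - 1 - (m - 1 - i) = i + 1 by omega]
    exact mul_succ_add_modEq m i
  · exact mul_succ_add_modEq m j

/-- For `n = p - 1`, every pair `(i, j)` with `i + j ≤ p - 4` is Fermat-admissible,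
and the number of Fermat-admissible pairs is `(p-2)*(p-3)/2`, the full genus of
`F_{p-1}`; hence `F_{p-1}` is ordinary. -/
theorem fermatAdmissible_p_sub_one (p n : ℕ) (hp : p.Prime) (hn : n = p - 1) :
    (∀ i j : ℕ, (i : ℤ) + j ≤ (p : ℤ) - 4 → FermatAdmissible n p i j) ∧
    2 * {ij : ℕ × ℕ | (ij.1 : ℤ) + ij.2 ≤ (p : ℤ) - 4 ∧
          FermatAdmissible n p ij.1 ij.2}.ncard
      = (p - 2) * (p - 3) := by
  subst hn
  have hadm : ∀ i j : ℕ, (i : ℤ) + j ≤ (p : ℤ) - 4 → FermatAdmissible (p - 1) p i j :=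
    fun i j hij => fermatAdmissible_of_add_le (by omega)
  refine ⟨hadm, ?_⟩
  have hset : {ij : ℕ × ℕ | (ij.1 : ℤ) + ij.2 ≤ (p : ℤ) - 4 ∧
      FermatAdmissible (p - 1) p ij.1 ij.2} = {ij : ℕ × ℕ | ij.1 + ij.2 < p - 3} := by
    ext ij
    simp only [Set.mem_ofPred_eq]
    exact ⟨fun h => by omega, fun h => ⟨by omega, hadm _ _ (by omega)⟩⟩
  rw [hset, two_mul_ncard_add_lt]
  rcases le_or_gt p 3 with h | h
  · simp [Nat.sub_eq_zero_of_le h]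
  · rw [show p - 3 + 1 = p - 2 by omega]
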